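/- Let M_1 = X⊗Z⊗Z⊗X⊗I, M_2 = I⊗X⊗Z⊗Z⊗X, M_3 = X⊗I⊗X⊗Z⊗Z, M_4 = Z⊗X⊗I⊗X⊗Z be the four stabilizer generators of the five-qubit code. For a function f : Fin 5 → {I, X, Y, Z}, let E(f) denote the Kronecker product f(0) ⊗ f(1) ⊗ f(2) ⊗ f(3) ⊗ f(4), and define the syndrome of f to be the vector (s_1, s_2, s_3, s_4) ∈ (ZMod 2)^4 where s_j = 1 if E(f) anticommutes with M_j and s_j = 0 if E(f) commutes with M_j. If f and g are two functions Fin 5 → {I, X, Y, Z}, each taking at most one non-identity value, and f and g have the same syndrome, then f = g. (That is, the five-qubit code corrects any single-qubit Pauli error.) -/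

import Mathlib

open Kronecker

noncomputable section

/-- The Pauli matrix `X`. -/
def PX : Matrix (Fin 2) (Fin 2) ℂ := !![0, 1; 1, 0]

/-- The Pauli matrix `Y`. -/
def PY : Matrix (Fin 2) (Fin 2) ℂ := !![0, -Complex.I; Complex.I, 0]

/-- The Pauli matrix `Z`. -/
def PZ : Matrix (Fin 2) (Fin 2) ℂ := !![1, 0; 0, -1]

/-- Index type for five-fold Kronecker products of 2×2 matrices. -/
abbrev Q5 := ((((Fin 2 × Fin 2) × Fin 2) × Fin 2) × Fin 2)

/-- The five-fold Kronecker product `f 0 ⊗ f 1 ⊗ f 2 ⊗ f 3 ⊗ f 4`. -/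
def kron5 (f : Fin 5 → Matrix (Fin 2) (Fin 2) ℂ) : Matrix Q5 Q5 ℂ :=
  f 0 ⊗ₖ f 1 ⊗ₖ f 2 ⊗ₖ f 3 ⊗ₖ f 4

/-- The four stabilizer generators of the five-qubit code. -/
def M5 : Fin 4 → Matrix Q5 Q5 ℂ :=
  ![kron5 ![PX, PZ, PZ, PX, 1],
    kron5 ![1, PX, PZ, PZ, PX],
    kron5 ![PX, 1, PX, PZ, PZ],
    kron5 ![PZ, PX, 1, PX, PZ]]

open Classical in
/-- The syndrome of a Pauli error `kron5 f` relative to the five-qubit code: the `j`-th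
bit is `1` if the error anticommutes with the `j`-th stabilizer generator, and `0` if it
commutes with it. -/
def syndrome (f : Fin 5 → Matrix (Fin 2) (Fin 2) ℂ) : Fin 4 → ZMod 2 :=
  fun j => if kron5 f * M5 j = -(M5 j * kron5 f) then 1 else 0

/-- The Pauli matrix with the given binary symplectic coordinates. -/
def pauli (a : ZMod 2 × ZMod 2) : Matrix (Fin 2) (Fin 2) ℂ :=
  if a.1 = 0 then if a.2 = 0 then 1 else PZ
  else if a.2 = 0 then PX else PY

/-- The symplectic form that records whether two Pauli matrices anticommute. -/
def pauliForm (a b : ZMod 2 × ZMod 2) : ZMod 2 := a.1 * b.2 + a.2 * b.1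

/-- The character of `ZMod 2` with values `1` and `-1`. -/
def pauliSign (x : ZMod 2) : ℂ := if x = 0 then 1 else -1

lemma ZMod.eq_zero_or_eq_one : ∀ x : ZMod 2, x = 0 ∨ x = 1 := by
  decide

lemma pauliSign_add (x y : ZMod 2) : pauliSign (x + y) = pauliSign x * pauliSign y := by
  have h : (1 + 1 : ZMod 2) = 0 := by decide
  obtain rfl | rfl := ZMod.eq_zero_or_eq_one x <;>
  obtain rfl | rfl := ZMod.eq_zero_or_eq_one y <;>
  simp [pauliSign, h]

lemma pauli_mul_comm (a b : ZMod 2 × ZMod 2) :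
    pauli a * pauli b = pauliSign (pauliForm a b) • (pauli b * pauli a) := by
  have h : (1 + 1 : ZMod 2) = 0 := by decide
  obtain ⟨a₁, a₂⟩ := a
  obtain ⟨b₁, b₂⟩ := b
  obtain rfl | rfl := ZMod.eq_zero_or_eq_one a₁ <;>
  obtain rfl | rfl := ZMod.eq_zero_or_eq_one a₂ <;>
  obtain rfl | rfl := ZMod.eq_zero_or_eq_one b₁ <;>
  obtain rfl | rfl := ZMod.eq_zero_or_eq_one b₂ <;>
  simp [pauli, pauliForm, pauliSign, h, PX, PY, PZ, Matrix.one_fin_two]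

lemma pauli_mul_self (a : ZMod 2 × ZMod 2) : pauli a * pauli a = 1 := by
  obtain ⟨a₁, a₂⟩ := a
  obtain rfl | rfl := ZMod.eq_zero_or_eq_one a₁ <;>
  obtain rfl | rfl := ZMod.eq_zero_or_eq_one a₂ <;>
  simp [pauli, PX, PY, PZ, Matrix.one_fin_two]

lemma mem_range_pauli {A : Matrix (Fin 2) (Fin 2) ℂ}
    (hA : A ∈ ({1, PX, PY, PZ} : Set (Matrix (Fin 2) (Fin 2) ℂ))) : ∃ a, pauli a = A := by
  rcases hA with rfl | rfl | rfl | rfl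
  · exact ⟨(0, 0), by simp [pauli]⟩
  · exact ⟨(1, 0), by simp [pauli]⟩
  · exact ⟨(1, 1), by simp [pauli]⟩
  · exact ⟨(0, 1), by simp [pauli]⟩

lemma kron5_mul (f g : Fin 5 → Matrix (Fin 2) (Fin 2) ℂ) :
    kron5 f * kron5 g = kron5 (fun i => f i * g i) := by
  simp only [kron5, Matrix.mul_kronecker_mul]

lemma kron5_smul (c : Fin 5 → ℂ) (f : Fin 5 → Matrix (Fin 2) (Fin 2) ℂ) :
    kron5 (fun i => c i • f i) = (∏ i, c i) • kron5 f := by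
  simp only [kron5, Matrix.smul_kronecker, Matrix.kronecker_smul, smul_smul, Fin.prod_univ_five]
  congr 1
  ring

lemma kron5_one : kron5 (fun _ => 1) = 1 := by
  simp [kron5]

lemma kron5_pauli_mul_comm (a b : Fin 5 → ZMod 2 × ZMod 2) :
    kron5 (fun i => pauli (a i)) * kron5 (fun i => pauli (b i)) =
      pauliSign (∑ i, pauliForm (a i) (b i)) •
        (kron5 (fun i => pauli (b i)) * kron5 (fun i => pauli (a i))) := by
  simp only [kron5_mul, pauli_mul_comm (a _) (b _), kron5_smul]
  simp only [Fin.sum_univ_five, Fin.prod_univ_five, pauliSign_add]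

lemma kron5_pauli_mul_self (a : Fin 5 → ZMod 2 × ZMod 2) :
    kron5 (fun i => pauli (a i)) * kron5 (fun i => pauli (a i)) = 1 := by
  simp only [kron5_mul, pauli_mul_self, kron5_one]

lemma kron5_pauli_mul_ne_zero (a b : Fin 5 → ZMod 2 × ZMod 2) :
    kron5 (fun i => pauli (a i)) * kron5 (fun i => pauli (b i)) ≠ 0 := by
  intro h
  have hb : kron5 (fun i => pauli (b i)) = 0 := by
    rw [← one_mul (kron5 fun i => pauli (b i)), ← kron5_pauli_mul_self a, mul_assoc, h, mul_zero]
  have h₁ := kron5_pauli_mul_self b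
  rw [hb, mul_zero] at h₁
  exact zero_ne_one h₁

lemma kron5_pauli_anticommute_iff (a b : Fin 5 → ZMod 2 × ZMod 2) :
    kron5 (fun i => pauli (a i)) * kron5 (fun i => pauli (b i)) =
        -(kron5 (fun i => pauli (b i)) * kron5 (fun i => pauli (a i))) ↔
      ∑ i, pauliForm (a i) (b i) = 1 := by
  rw [kron5_pauli_mul_comm]
  generalize ∑ i, pauliForm (a i) (b i) = s
  have hne := kron5_pauli_mul_ne_zero b a
  obtain rfl | rfl := ZMod.eq_zero_or_eq_one s
  · simp only [pauliSign, if_true, one_smul, zero_ne_one, iff_false]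
    intro h
    rw [eq_neg_iff_add_eq_zero, ← two_smul ℂ] at h
    exact hne ((smul_eq_zero.1 h).resolve_left two_ne_zero)
  · simp [pauliSign]

/-- The symplectic coordinates of the stabilizer generators of the five-qubit code. -/
def stabilizerCoord : Fin 4 → Fin 5 → ZMod 2 × ZMod 2 :=
  ![![(1, 0), (0, 1), (0, 1), (1, 0), (0, 0)],
    ![(0, 0), (1, 0), (0, 1), (0, 1), (1, 0)],
    ![(1, 0), (0, 0), (1, 0), (0, 1), (0, 1)],
    ![(0, 1), (1, 0), (0, 0), (1, 0), (0, 1)]]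

lemma M5_eq_kron5_pauli (j : Fin 4) : M5 j = kron5 (fun i => pauli (stabilizerCoord j i)) := by
  fin_cases j <;> simp [M5, kron5, stabilizerCoord, pauli]

lemma syndrome_pauli (a : Fin 5 → ZMod 2 × ZMod 2) :
    syndrome (fun i => pauli (a i)) = fun j => ∑ i, pauliForm (a i) (stabilizerCoord j i) := by
  funext j
  simp only [syndrome, M5_eq_kron5_pauli, kron5_pauli_anticommute_iff]
  generalize ∑ i, pauliForm (a i) (stabilizerCoord j i) = s
  obtain rfl | rfl := ZMod.eq_zero_or_eq_one s <;>
  simp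

lemma sum_pauliForm_single (i : Fin 5) (p : ZMod 2 × ZMod 2) (b : Fin 5 → ZMod 2 × ZMod 2) :
    ∑ k, pauliForm ((Pi.single i p : Fin 5 → ZMod 2 × ZMod 2) k) (b k) = pauliForm p (b i) := by
  rw [Finset.sum_eq_single i]
  · simp
  · intro k _ hk
    simp [hk, pauliForm]
  · simp

lemma pauliForm_stabilizerCoord_injective :
    ∀ (i j : Fin 5) (p q : ZMod 2 × ZMod 2),
      (∀ k, pauliForm p (stabilizerCoord k i) = pauliForm q (stabilizerCoord k j)) →
        p = q ∧ (p = 0 ∨ i = j) := by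
  decide

lemma exists_eq_pauli_single {f : Fin 5 → Matrix (Fin 2) (Fin 2) ℂ}
    (hf : ∀ i, f i ∈ ({1, PX, PY, PZ} : Set (Matrix (Fin 2) (Fin 2) ℂ)))
    (hwf : {i | f i ≠ 1}.ncard ≤ 1) :
    ∃ i p, f = fun k => pauli ((Pi.single i p : Fin 5 → ZMod 2 × ZMod 2) k) := by
  choose a ha using fun i => mem_range_pauli (hf i)
  obtain ⟨i, hi⟩ := (Set.ncard_le_one_iff_subset_singleton).1 hwf
  refine ⟨i, a i, funext fun k => ?_⟩
  by_cases hk : k = i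
  · subst hk
    simp [ha]
  · have h₁ : f k = 1 := by
      by_contra h
      exact hk (hi h)
    simp [hk, h₁, pauli]

/-- The five-qubit code corrects any single-qubit Pauli error: two Pauli errors of weight
at most one with the same syndrome must be equal. -/
theorem five_qubit_code_corrects_one_error
    (f g : Fin 5 → Matrix (Fin 2) (Fin 2) ℂ)
    (hf : ∀ i, f i ∈ ({1, PX, PY, PZ} : Set (Matrix (Fin 2) (Fin 2) ℂ)))
    (hg : ∀ i, g i ∈ ({1, PX, PY, PZ} : Set (Matrix (Fin 2) (Fin 2) ℂ)))
    (hwf : {i | f i ≠ 1}.ncard ≤ 1) (hwg : {i | g i ≠ 1}.ncard ≤ 1)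
    (hsyn : syndrome f = syndrome g) :
    f = g := by
  obtain ⟨i, p, rfl⟩ := exists_eq_pauli_single hf hwf
  obtain ⟨j, q, rfl⟩ := exists_eq_pauli_single hg hwg
  simp only [syndrome_pauli, sum_pauliForm_single] at hsyn
  obtain ⟨rfl, rfl | rfl⟩ := pauliForm_stabilizerCoord_injective i j p q (congrFun hsyn)
  · simp
  · rfl

end
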